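/- arXiv:1512.07136 — 5 statements merged into one kernel-verified Lean document; each statement's English description precedes it below -/
import Mathlib

section
/- Let f be a polynomial of degree d in variables x_1, ..., x_m over a field. Then the divided symmetrization DS(f) = Σ_π f(x_{π(1)}, ..., x_{π(m)}) / Π_{i<j} (x_{π(i)} − x_{π(j)}), where the sum is over all m! permutations π of {1,...,m}, is a polynomial (i.e., the rational function Σ_π f∘π / Π_{i<j}(x_{π(i)} − x_{π(j)}) in the fraction field of the polynomial ring lies in the polynomial ring) of degree at most d − m(m−1)/2. -/
open MvPolynomial

/-- Partial divided symmetrization of a polynomial `f` over the graph on the variables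
`x_0 < x_1 < ... < x_{m-1}` whose (ordered) edges form the finset `E`:
`DS_G(f) = Σ_π (f ∘ π) / Π_{(x,y) ∈ E} (x_π − y_π)`,
the sum being over all `m!` permutations of the variables. -/
noncomputable def DS {K : Type*} [Field K] {m : ℕ} (E : Finset (Fin m × Fin m))
    (f : MvPolynomial (Fin m) K) : FractionRing (MvPolynomial (Fin m) K) :=
  ∑ π : Equiv.Perm (Fin m),
    algebraMap (MvPolynomial (Fin m) K) (FractionRing (MvPolynomial (Fin m) K))
        (rename (⇑π) f) /
      algebraMap (MvPolynomial (Fin m) K) (FractionRing (MvPolynomial (Fin m) K))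
        (rename (⇑π) (∏ e ∈ E, (X e.1 - X e.2)))

namespace MvPolynomial

variable {σ R : Type*} [CommRing R]

theorem X_sub_X_ne_zero [Nontrivial R] {i j : σ} (h : i ≠ j) :
    (X i - X j : MvPolynomial σ R) ≠ 0 :=
  sub_ne_zero.2 fun e => h (X_injective e)

theorem isHomogeneous_X_sub_X (i j : σ) : (X i - X j : MvPolynomial σ R).IsHomogeneous 1 :=
  (isHomogeneous_X R i).sub (isHomogeneous_X R j)

theorem irreducible_X_sub_X [IsDomain R] {i j : σ} (h : i ≠ j) :
    Irreducible (X i - X j : MvPolynomial σ R) := by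
  classical
  refine irreducible_of_totalDegree_eq_one
    ((isHomogeneous_X_sub_X i j).totalDegree (X_sub_X_ne_zero h)) fun x hx => ?_
  have := hx (Finsupp.single i 1)
  simp only [coeff_sub, coeff_X, if_true, Finsupp.single_left_inj one_ne_zero, h.symm,
    if_false, sub_zero] at this
  exact isUnit_of_dvd_one this

theorem isRelPrime_X_sub_X [IsDomain R] {i j k l : σ} (hij : i ≠ j) (hkl : k ≠ l)
    (h : ¬(k = i ∧ l = j)) (h' : ¬(k = j ∧ l = i)) :
    IsRelPrime (X i - X j : MvPolynomial σ R) (X k - X l) := by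
  classical
  rw [(irreducible_X_sub_X hij).isRelPrime_iff_not_dvd]
  intro hd
  have := map_dvd (rename (R := R) (Function.update id j i)) hd
  simp only [map_sub, rename_X, Function.update_self, Function.update_of_ne hij, id,
    sub_self, zero_dvd_iff, sub_eq_zero] at this
  have := X_injective this
  simp only [Function.update_apply, id] at this
  grind

theorem X_sub_X_dvd_sub_rename_swap [DecidableEq σ] (i j : σ) (p : MvPolynomial σ R) :
    X i - X j ∣ p - rename (Equiv.swap i j) p := by
  rw [← Ideal.mem_span_singleton, ← Ideal.Quotient.mk_eq_mk_iff_sub_mem]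
  have hX : Ideal.Quotient.mk (Ideal.span {(X i - X j : MvPolynomial σ R)}) (X i) =
      Ideal.Quotient.mk _ (X j) :=
    (Ideal.Quotient.mk_eq_mk_iff_sub_mem _ _).2 (Ideal.mem_span_singleton_self _)
  refine RingHom.congr_fun (f := Ideal.Quotient.mk (Ideal.span {X i - X j}))
    (g := (Ideal.Quotient.mk _).comp (rename (Equiv.swap i j)).toRingHom) ?_ p
  refine ringHom_ext (by simp) fun k => ?_
  simp only [RingHom.comp_apply, AlgHom.toRingHom_eq_coe, RingHom.coe_coe, rename_X]
  rcases eq_or_ne k i with rfl | hi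
  · simpa using hX
  rcases eq_or_ne k j with rfl | hj
  · simpa using hX.symm
  · rw [Equiv.swap_apply_of_ne_of_ne hi hj]

/-- The alternating sum of a polynomial over all permutations of its variables. -/
noncomputable def antisymmetrization [Fintype σ] [DecidableEq σ] (p : MvPolynomial σ R) :
    MvPolynomial σ R :=
  ∑ π : Equiv.Perm σ, ((π.sign : ℤ) : MvPolynomial σ R) * rename π p

theorem X_sub_X_dvd_antisymmetrization [Fintype σ] [DecidableEq σ] {i j : σ} (h : i ≠ j)
    (p : MvPolynomial σ R) : X i - X j ∣ antisymmetrization p := by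
  rw [← Ideal.mem_span_singleton, ← Ideal.Quotient.eq_zero_iff_mem, antisymmetrization, map_sum]
  refine Finset.sum_involution (fun π _ => Equiv.swap i j * π) (fun π _ => ?_) (fun π _ _ => ?_)
    (fun _ _ => Finset.mem_univ _) (fun π _ => by simp [← mul_assoc])
  · rw [← map_add, Ideal.Quotient.eq_zero_iff_mem, Ideal.mem_span_singleton]
    convert (X_sub_X_dvd_sub_rename_swap i j (rename π p)).mul_left
      ((π.sign : ℤ) : MvPolynomial σ R) using 1
    rw [Equiv.Perm.sign_mul, Equiv.Perm.sign_swap h, rename_rename, Equiv.Perm.coe_mul]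
    push_cast
    ring
  · simpa using Equiv.swap_eq_one_iff.not.2 h

theorem totalDegree_antisymmetrization_le [Fintype σ] [DecidableEq σ] (p : MvPolynomial σ R) :
    (antisymmetrization p).totalDegree ≤ p.totalDegree := by
  refine totalDegree_finsetSum_le fun π _ => ?_
  rw [← map_intCast (C : R →+* MvPolynomial σ R), ← smul_eq_C_mul]
  exact (totalDegree_smul_le _ _).trans (totalDegree_rename_le _ _)

end MvPolynomial

theorem Fin.card_filter_fst_lt_snd (m : ℕ) :
    (Finset.univ.filter fun p : Fin m × Fin m => p.1 < p.2).card = m * (m - 1) / 2 := by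
  rw [← Finset.univ_product_univ, Finset.card_product_filter_lt, Finset.card_fin,
    Nat.choose_two_right]

namespace MvPolynomial

variable {R : Type*} [CommRing R] {m : ℕ}

/-- The product `∏_{i < j} (x_i - x_j)`. -/
noncomputable def vandermondeProd (R : Type*) [CommRing R] (m : ℕ) : MvPolynomial (Fin m) R :=
  ∏ e ∈ Finset.univ.filter fun p : Fin m × Fin m => p.1 < p.2, (X e.1 - X e.2)

theorem vandermondeProd_ne_zero [IsDomain R] : vandermondeProd R m ≠ 0 :=
  Finset.prod_ne_zero_iff.2 fun _ he => X_sub_X_ne_zero (Finset.mem_filter.1 he).2.ne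

theorem totalDegree_vandermondeProd [IsDomain R] :
    (vandermondeProd R m).totalDegree = m * (m - 1) / 2 := by
  have h := IsHomogeneous.prod (Finset.univ.filter fun p : Fin m × Fin m => p.1 < p.2)
    (fun e => (X e.1 - X e.2 : MvPolynomial (Fin m) R)) (fun _ => 1)
    fun e _ => isHomogeneous_X_sub_X e.1 e.2
  rw [← Fin.card_filter_fst_lt_snd, Finset.card_eq_sum_ones]
  exact h.totalDegree vandermondeProd_ne_zero

theorem rename_vandermondeProd (π : Equiv.Perm (Fin m)) :
    rename π (vandermondeProd R m) = ((π.sign : ℤ) : MvPolynomial (Fin m) R) *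
      vandermondeProd R m := by
  have h (f : Fin m → Fin m → MvPolynomial (Fin m) R) :
      ∏ e ∈ Finset.univ.filter (fun p : Fin m × Fin m => p.1 < p.2), f e.1 e.2 =
        ∏ i, ∏ j ∈ Finset.Ioi i, f i j := by
    rw [Finset.prod_filter, Fintype.prod_prod_type]
    simp_rw [← Finset.prod_filter, Finset.filter_lt_eq_Ioi]
  simp only [vandermondeProd, map_prod, map_sub, rename_X]
  rw [h fun i j => X (π i) - X (π j), h fun i j => X i - X j]
  exact π.prod_Ioi_comp_eq_sign_mul_prod (f := fun i j => X i - X j) fun i j => by simp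

theorem vandermondeProd_dvd_antisymmetrization [IsDomain R] [UniqueFactorizationMonoid R]
    (p : MvPolynomial (Fin m) R) :
    vandermondeProd R m ∣ antisymmetrization p := by
  refine Finset.prod_dvd_of_isRelPrime (fun e he e' he' hne => ?_) fun e he =>
    X_sub_X_dvd_antisymmetrization (Finset.mem_filter.1 he).2.ne p
  have h := (Finset.mem_filter.1 he).2
  have h' := (Finset.mem_filter.1 he').2
  exact isRelPrime_X_sub_X h.ne h'.ne (fun hh => hne (Prod.ext hh.1.symm hh.2.symm))
    fun hh => (hh.1 ▸ hh.2 ▸ h').asymm h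

end MvPolynomial

theorem DS_eq_antisymmetrization_div {K : Type*} [Field K] {m : ℕ}
    (f : MvPolynomial (Fin m) K) :
    DS (Finset.univ.filter fun p : Fin m × Fin m => p.1 < p.2) f =
      algebraMap (MvPolynomial (Fin m) K) (FractionRing (MvPolynomial (Fin m) K))
          (antisymmetrization f) /
        algebraMap (MvPolynomial (Fin m) K) (FractionRing (MvPolynomial (Fin m) K))
          (vandermondeProd K m) := by
  rw [DS, antisymmetrization, map_sum, Finset.sum_div]
  refine Finset.sum_congr rfl fun π _ => ?_
  change _ / algebraMap _ _ (rename π (vandermondeProd K m)) = _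
  rw [rename_vandermondeProd, map_mul, map_mul]
  rcases Int.units_eq_one_or π.sign with h | h <;> simp [h, neg_div, div_neg]

/-- for a polynomial `f` of degree `d` in `m` variables over a field, the
divided symmetrization `DS(f) = Σ_π (f ∘ π) / Π_{i<j} (x_{π i} − x_{π j})` lies in the
polynomial ring, and as a polynomial it has degree at most `d − m(m−1)/2`. -/
theorem divided_symmetrization_is_polynomial {K : Type*} [Field K] (m d : ℕ)
    (f : MvPolynomial (Fin m) K) (hf : f.totalDegree = d) :
    ∃ g : MvPolynomial (Fin m) K,
      algebraMap (MvPolynomial (Fin m) K) (FractionRing (MvPolynomial (Fin m) K)) g =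
        DS (Finset.univ.filter fun p : Fin m × Fin m => p.1 < p.2) f ∧
      (g = 0 ∨ (g.totalDegree : ℤ) ≤ (d : ℤ) - ((m * (m - 1) / 2 : ℕ) : ℤ)) := by
  obtain ⟨g, hg⟩ := vandermondeProd_dvd_antisymmetrization f
  refine ⟨g, ?_, or_iff_not_imp_left.2 fun hg0 => ?_⟩
  · rw [DS_eq_antisymmetrization_div, hg, map_mul, mul_div_cancel_left₀]
    exact (map_ne_zero_iff _ (IsFractionRing.injective _ _)).2 vandermondeProd_ne_zero
  · have hdeg := totalDegree_antisymmetrization_le f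
    rw [hg, totalDegree_mul_of_isDomain vandermondeProd_ne_zero hg0,
      totalDegree_vandermondeProd, hf] at hdeg
    omega
end

section
/- Let f be a polynomial of degree d < m(m−1)/2 in variables x_1, ..., x_m over a field. Then the divided symmetrization DS(f) = Σ_π f(x_{π(1)}, ..., x_{π(m)}) / Π_{i<j} (x_{π(i)} − x_{π(j)}) vanishes identically. -/
open MvPolynomial

/-- The sum of the elements of a finite set of naturals is at least `0 + 1 + ⋯ + (#s - 1)`. -/
theorem sum_range_card_le_sum (s : Finset ℕ) : ∑ i ∈ Finset.range s.card, i ≤ ∑ i ∈ s, i := by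
  induction s using Finset.induction_on_max with
  | empty => simp
  | insert x s hx ih =>
    have hxs : x ∉ s := fun h => lt_irrefl x (hx x h)
    have hcard : s.card ≤ x := by
      simpa using Finset.card_le_card (fun y hy => Finset.mem_range.2 (hx y hy) : s ⊆ Finset.range x)
    rw [Finset.card_insert_of_notMem hxs, Finset.sum_range_succ, Finset.sum_insert hxs]
    omega

theorem Function.Injective.le_sum_fin {m : ℕ} {a : Fin m → ℕ} (ha : Function.Injective a) :
    m * (m - 1) / 2 ≤ ∑ i, a i := by
  have h := sum_range_card_le_sum (Finset.univ.image a)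
  rwa [Finset.card_image_of_injective _ ha, Finset.card_fin, Finset.sum_range_id,
    Finset.sum_image ha.injOn] at h

/-- The antisymmetrization of a monomial with a repeated exponent vanishes. -/
theorem sum_sign_smul_rename_monomial_eq_zero {K : Type*} [CommRing K] {m : ℕ} {a : Fin m →₀ ℕ}
    (ha : ¬ Function.Injective a) (c : K) :
    ∑ π : Equiv.Perm (Fin m), Equiv.Perm.sign π • rename (⇑π) (monomial a c) = 0 := by
  obtain ⟨i, j, hij, hne⟩ := Function.not_injective_iff.1 ha
  have hdet : (Matrix.of fun i j => (X i ^ a j : MvPolynomial (Fin m) K)).det = 0 :=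
    Matrix.det_zero_of_column_eq hne fun k => by simp [hij]
  have hren (π : Equiv.Perm (Fin m)) :
      rename (⇑π) (monomial a c) = C c * ∏ i, (X (π i) ^ a i : MvPolynomial (Fin m) K) := by
    rw [monomial_eq, Finsupp.prod_fintype _ _ (by simp)]
    simp
  simp_rw [hren, ← mul_smul_comm, ← Finset.mul_sum]
  rw [Matrix.det_apply] at hdet
  exact mul_eq_zero_of_right _ hdet

/-- The antisymmetrization of a polynomial of degree less than `m.choose 2` vanishes. -/
theorem sum_sign_smul_rename_eq_zero {K : Type*} [CommRing K] {m : ℕ}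
    {f : MvPolynomial (Fin m) K} (hf : f.totalDegree < m * (m - 1) / 2) :
    ∑ π : Equiv.Perm (Fin m), Equiv.Perm.sign π • rename (⇑π) f = 0 := by
  rw [f.as_sum]
  simp_rw [map_sum, Finset.smul_sum]
  rw [Finset.sum_comm]
  refine Finset.sum_eq_zero fun a ha => sum_sign_smul_rename_monomial_eq_zero (fun hinj => ?_) _
  have hle := le_totalDegree ha
  rw [Finsupp.sum_fintype _ _ (by simp)] at hle
  exact absurd (hinj.le_sum_fin.trans hle) (by omega)

theorem prod_lt_sub_eq_det_vandermonde {R : Type*} [CommRing R] {m : ℕ} (v : Fin m → R) :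
    ∏ e : Fin m × Fin m with e.1 < e.2, (v e.1 - v e.2) =
      (Matrix.vandermonde fun i => -v i).det := by
  rw [Matrix.det_vandermonde, Finset.prod_filter, Fintype.prod_prod_type]
  refine Finset.prod_congr rfl fun i _ => ?_
  rw [← Finset.prod_filter, Finset.filter_lt_eq_Ioi]
  exact Finset.prod_congr rfl fun j _ => by ring

theorem rename_prod_lt_sub {K : Type*} [CommRing K] {m : ℕ} (π : Equiv.Perm (Fin m)) :
    rename (⇑π) (∏ e : Fin m × Fin m with e.1 < e.2, (X e.1 - X e.2 : MvPolynomial (Fin m) K)) =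
      Equiv.Perm.sign π • ∏ e : Fin m × Fin m with e.1 < e.2, (X e.1 - X e.2) := by
  simp only [map_prod, map_sub, rename_X]
  rw [prod_lt_sub_eq_det_vandermonde (fun i => X i),
    prod_lt_sub_eq_det_vandermonde (fun i => X (π i)), Units.smul_def, zsmul_eq_mul,
    ← Matrix.det_permute]
  rfl

/-- for a polynomial `f` of degree `d < m(m−1)/2` in `m` variables over a
field, the divided symmetrization `DS(f) = Σ_π (f ∘ π) / Π_{i<j} (x_{π i} − x_{π j})`
vanishes identically. -/
theorem divided_symmetrization_vanishes_of_low_degree {K : Type*} [Field K] (m d : ℕ)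
    (f : MvPolynomial (Fin m) K) (hf : f.totalDegree = d) (hd : d < m * (m - 1) / 2) :
    DS (Finset.univ.filter fun p : Fin m × Fin m => p.1 < p.2) f = 0 := by
  subst hf
  have hsum := congrArg (algebraMap _ (FractionRing (MvPolynomial (Fin m) K)))
    (sum_sign_smul_rename_eq_zero hd)
  rw [map_sum, map_zero] at hsum
  unfold DS
  simp_rw [rename_prod_lt_sub]
  rw [← zero_div (algebraMap (MvPolynomial (Fin m) K) (FractionRing (MvPolynomial (Fin m) K))
    (∏ e : Fin m × Fin m with e.1 < e.2, (X e.1 - X e.2))), ← hsum, Finset.sum_div]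
  refine Finset.sum_congr rfl fun π _ => ?_
  rcases Int.units_eq_one_or (Equiv.Perm.sign π) with h | h <;> simp [h, div_neg, neg_div]
end

section
/- Let G = (V, E) be a graph on the ordered variable set V with |E| edges, and let f = g·h be a polynomial with deg f ≤ |E|, where g is a non-constant symmetric polynomial. Then DS_G(f) = 0. -/
open MvPolynomial

namespace MvPolynomial

/-- The pairs `(i, j)` of indices with `i < j`. -/
def ltPairs (m : ℕ) : Finset (Fin m × Fin m) := Finset.univ.filter fun e => e.1 < e.2

theorem card_ltPairs (m : ℕ) : (ltPairs m).card = ∑ j ∈ Finset.range m, j := by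
  rw [ltPairs, Finset.card_filter, ← Finset.univ_product_univ, Finset.sum_product_right,
    ← Fin.sum_univ_eq_sum_range (fun j => j)]
  refine Finset.sum_congr rfl fun j _ => ?_
  rw [← Finset.card_filter, Finset.filter_gt_eq_Iio, Fin.card_Iio]

theorem card_ltPairs_le_sum_of_injective {m : ℕ} {a : Fin m → ℕ} (ha : Function.Injective a) :
    (ltPairs m).card ≤ ∑ i, a i := by
  have hinj : Function.Injective fun i => (a i : ℤ) := Nat.cast_injective.comp ha
  have h := Finset.sum_range_le_sum (s := Finset.univ.image fun i => (a i : ℤ)) (c := 0)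
    (by simp)
  rw [Finset.card_image_of_injective _ hinj, Finset.sum_image fun _ _ _ _ e => hinj e] at h
  rw [card_ltPairs]
  rw [← Nat.cast_le (α := ℤ)]
  simpa using h

variable {R : Type*} [CommRing R] {m : ℕ}

theorem sum_sign_smul_rename_monomial_of_not_injective {a : Fin m →₀ ℕ}
    (ha : ¬ Function.Injective a) (r : R) :
    ∑ π : Equiv.Perm (Fin m), Equiv.Perm.sign π • rename π (monomial a r) = 0 := by
  obtain ⟨i, j, hij, hne⟩ : ∃ i j, a i = a j ∧ i ≠ j := by
    simpa [Function.Injective] using ha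
  have h : (Matrix.of fun k l => (X k : MvPolynomial (Fin m) R) ^ a l).det = 0 :=
    Matrix.det_zero_of_column_eq hne fun k => by simp [hij]
  rw [Matrix.det_apply] at h
  have hπ (π : Equiv.Perm (Fin m)) :
      Equiv.Perm.sign π • rename π (monomial a r) =
        C r * Equiv.Perm.sign π • ∏ l, (X (π l) : MvPolynomial (Fin m) R) ^ a l := by
    rw [monomial_eq, Finsupp.prod_fintype _ _ (by simp), mul_smul_comm]
    simp
  simp only [Matrix.of_apply] at h
  simp_rw [hπ, ← Finset.mul_sum, h, mul_zero]

theorem sum_sign_smul_rename_eq_zero {q : MvPolynomial (Fin m) R}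
    (hq : q.totalDegree < (ltPairs m).card) :
    ∑ π : Equiv.Perm (Fin m), Equiv.Perm.sign π • rename π q = 0 := by
  rw [q.as_sum]
  simp_rw [map_sum, Finset.smul_sum]
  rw [Finset.sum_comm]
  refine Finset.sum_eq_zero fun a ha => sum_sign_smul_rename_monomial_of_not_injective ?_ _
  intro hinj
  have h₁ := le_totalDegree ha
  rw [Finsupp.sum_fintype _ _ (by simp)] at h₁
  exact absurd (card_ltPairs_le_sum_of_injective hinj) (by omega)

theorem prod_ltPairs_eq_det_vandermonde {A : Type*} [CommRing A] (v : Fin m → A) :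
    ∏ e ∈ ltPairs m, (v e.1 - v e.2) = (Matrix.vandermonde fun i => -v i).det := by
  rw [Matrix.det_vandermonde, ltPairs, Finset.prod_filter, ← Finset.univ_product_univ,
    Finset.prod_product]
  refine Finset.prod_congr rfl fun i _ => ?_
  rw [← Finset.prod_filter, Finset.filter_lt_eq_Ioi]
  exact Finset.prod_congr rfl fun j _ => by ring

theorem rename_prod_ltPairs (π : Equiv.Perm (Fin m)) :
    rename π (∏ e ∈ ltPairs m, (X e.1 - X e.2 : MvPolynomial (Fin m) R)) =
      Equiv.Perm.sign π • ∏ e ∈ ltPairs m, (X e.1 - X e.2 : MvPolynomial (Fin m) R) := by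
  rw [map_prod]
  simp_rw [map_sub, rename_X]
  rw [prod_ltPairs_eq_det_vandermonde (fun i => X (π i)), prod_ltPairs_eq_det_vandermonde X,
    Units.smul_def, zsmul_eq_mul, ← Matrix.det_permute]
  rfl

theorem totalDegree_prod_X_sub_X_le (s : Finset (Fin m × Fin m)) :
    (∏ e ∈ s, (X e.1 - X e.2 : MvPolynomial (Fin m) R)).totalDegree ≤ s.card := by
  rcases subsingleton_or_nontrivial R with _ | _
  · simp [Subsingleton.elim (∏ e ∈ s, (X e.1 - X e.2 : MvPolynomial (Fin m) R)) 0]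
  refine (totalDegree_finsetProd _ _).trans ?_
  rw [Finset.card_eq_sum_ones]
  exact Finset.sum_le_sum fun e _ => (totalDegree_sub _ _).trans (by simp)

end MvPolynomial

section

variable {K : Type*} [Field K] {m : ℕ} {E : Finset (Fin m × Fin m)}

theorem DS_mul_of_isSymmetric {g : MvPolynomial (Fin m) K} (hg : g.IsSymmetric)
    (h : MvPolynomial (Fin m) K) : DS E (g * h) = algebraMap _ _ g * DS E h := by
  simp_rw [DS, Finset.mul_sum, map_mul, hg _, mul_div_assoc]

theorem DS_eq_zero_of_totalDegree_lt (hE : ∀ e ∈ E, e.1 < e.2) {h : MvPolynomial (Fin m) K}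
    (hdeg : h.totalDegree < E.card) : DS E h = 0 := by
  have hsub : E ⊆ ltPairs m := fun e he => by simpa [ltPairs] using hE e he
  set D : MvPolynomial (Fin m) K := ∏ e ∈ ltPairs m, (X e.1 - X e.2)
  set P : MvPolynomial (Fin m) K := ∏ e ∈ E, (X e.1 - X e.2)
  set Q : MvPolynomial (Fin m) K := ∏ e ∈ ltPairs m \ E, (X e.1 - X e.2)
  have hPQ : Q * P = D := Finset.prod_sdiff hsub
  have hD : D ≠ 0 := Finset.prod_ne_zero_iff.mpr fun e he => by
    rw [sub_ne_zero]
    exact fun hX => (Finset.mem_filter.mp he).2.ne (X_injective hX)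
  have hQ : Q ≠ 0 := left_ne_zero_of_mul (hPQ ▸ hD)
  have hinj := IsFractionRing.injective (MvPolynomial (Fin m) K)
    (FractionRing (MvPolynomial (Fin m) K))
  have hterm (π : Equiv.Perm (Fin m)) :
      algebraMap _ (FractionRing (MvPolynomial (Fin m) K)) (rename π h) /
          algebraMap _ _ (rename π P) =
        algebraMap _ _ (Equiv.Perm.sign π • rename π (h * Q)) / algebraMap _ _ D := by
    have hQπ : algebraMap _ (FractionRing (MvPolynomial (Fin m) K)) (rename π Q) ≠ 0 := by
      rw [map_ne_zero_iff _ hinj, map_ne_zero_iff _ (rename_injective _ π.injective)]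
      exact hQ
    rw [← mul_div_mul_right _ _ hQπ, ← map_mul, ← map_mul, ← map_mul, ← map_mul, mul_comm P,
      hPQ, rename_prod_ltPairs]
    rcases Int.units_eq_one_or (Equiv.Perm.sign π) with hs | hs <;>
      simp [hs, D, Units.smul_def, neg_div, div_neg]
  have hlt : (h * Q).totalDegree < (ltPairs m).card := by
    have h₁ := totalDegree_mul h Q
    have h₂ : Q.totalDegree ≤ _ := totalDegree_prod_X_sub_X_le (ltPairs m \ E)
    have h₃ := Finset.card_sdiff_add_card_eq_card hsub
    omega
  simp_rw [DS]
  rw [Finset.sum_congr rfl fun π _ => hterm π, ← Finset.sum_div, ← map_sum,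
    sum_sign_smul_rename_eq_zero hlt, map_zero, zero_div]

end

/-- if `f = g·h` with `deg f ≤ |E|` and `g` a non-constant symmetric
polynomial, then `DS_G(f) = 0`. -/
theorem divided_symmetrization_symmetric_factor {K : Type*} [Field K] (m : ℕ)
    (E : Finset (Fin m × Fin m)) (hE : ∀ e ∈ E, e.1 < e.2)
    (g h : MvPolynomial (Fin m) K) (hg : g.IsSymmetric) (hgc : g.totalDegree ≠ 0)
    (hdeg : (g * h).totalDegree ≤ E.card) :
    DS E (g * h) = 0 := by
  have hg0 : g ≠ 0 := by
    rintro rfl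
    exact hgc totalDegree_zero
  rcases eq_or_ne h 0 with rfl | hh
  · simp [DS]
  · rw [totalDegree_mul_of_isDomain hg0 hh] at hdeg
    rw [DS_mul_of_isSymmetric hg, DS_eq_zero_of_totalDegree_lt hE (by omega), mul_zero]
end

section
/- Let G be the path on the ordered variable set V = {x_0, x_1, ..., x_n} with edges (x_i, x_{i+1}), 0 ≤ i ≤ n−1, and let Φ = DS_G. Set y_i = x_0 + x_1 + ... + x_i. Then for any polynomial g of degree n−1, Φ(y_n · g) = 0, and for any 0 ≤ k ≤ n−1 and any polynomial g of degree n−2, Φ(y_k · (x_{k+1} − x_k) · g) = 0. -/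
open MvPolynomial

/-- The edge set of the path `x_0 — x_1 — ⋯ — x_n`: the pairs `(x_i, x_{i+1})`,
`0 ≤ i ≤ n−1`. -/
def pathEdges (n : ℕ) : Finset (Fin (n + 1) × Fin (n + 1)) :=
  Finset.univ.image fun i : Fin n => (i.castSucc, i.succ)

/-- `pathY n K k = y_k = x_0 + x_1 + ⋯ + x_k`. -/
noncomputable def pathY (n : ℕ) (K : Type*) [Field K] (k : Fin (n + 1)) :
    MvPolynomial (Fin (n + 1)) K :=
  ∑ j ∈ Finset.Iic k, X j

/-- The increasing pairs of indices lying in a common fibre of `c`. -/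
def fiberPairs {m : ℕ} (c : Fin m → ℕ) : Finset (Fin m × Fin m) :=
  Finset.univ.filter fun e => e.1 < e.2 ∧ c e.1 = c e.2

/-- The pairs of indices on which `c` increases strictly. -/
def crossPairs {m : ℕ} (c : Fin m → ℕ) : Finset (Fin m × Fin m) :=
  Finset.univ.filter fun e => c e.1 < c e.2

/-- The product of `x_i - x_j` over all `i < j`. -/
noncomputable def differenceProduct (K : Type*) [Field K] (m : ℕ) : MvPolynomial (Fin m) K :=
  ∏ e : Fin m × Fin m with e.1 < e.2, (X e.1 - X e.2)

section

variable {K : Type*} [Field K] {m : ℕ}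

lemma differenceProduct_eq_det :
    differenceProduct K m =
      (Matrix.vandermonde fun i : Fin m => (-X i : MvPolynomial (Fin m) K)).det := by
  rw [Matrix.det_vandermonde, differenceProduct, Finset.prod_filter, Fintype.prod_prod_type]
  refine Finset.prod_congr rfl fun i _ => ?_
  rw [← Finset.prod_filter]
  refine Finset.prod_congr (by ext; simp) fun j _ => ?_
  ring

lemma rename_differenceProduct (π : Equiv.Perm (Fin m)) :
    rename π (differenceProduct K m) = (Equiv.Perm.sign π : ℤ) * differenceProduct K m := by
  rw [differenceProduct_eq_det, ← Matrix.det_permute, AlgHom.map_det]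
  congr 1
  ext1 i j
  simp [Matrix.vandermonde_apply]

lemma differenceProduct_ne_zero : differenceProduct K m ≠ 0 := by
  rw [differenceProduct, Finset.prod_ne_zero_iff]
  intro e he h
  exact (Finset.mem_filter.mp he).2.ne (X_injective (sub_eq_zero.mp h))

/-- An exponent vector that is injective on every fibre of `c` has large degree. -/
lemma card_fiberPairs_le_sum {c : Fin m → ℕ} {α : Fin m → ℕ}
    (h : ∀ a b, a ≠ b → c a = c b → α a ≠ α b) :
    (fiberPairs c).card ≤ ∑ i, α i := by
  have hcard : (Finset.univ.sigma fun i : Fin m => Finset.range (α i)).card = ∑ i, α i := by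
    simp
  rw [← hcard]
  refine Finset.card_le_card_of_injOn
    (fun e => if α e.1 < α e.2 then ⟨e.2, α e.1⟩ else ⟨e.1, α e.2⟩) ?_ ?_
  · rintro ⟨a, b⟩ he
    simp only [fiberPairs, Finset.coe_filter, Finset.mem_univ, true_and, Set.mem_ofPred_eq] at he
    have := h a b he.1.ne he.2
    simp only [Finset.coe_sigma, Set.mem_sigma_iff, Finset.mem_coe]
    split_ifs <;> simp <;> omega
  · rintro ⟨a, b⟩ he ⟨a', b'⟩ he' heq
    simp only [fiberPairs, Finset.coe_filter, Finset.mem_univ, true_and, Set.mem_ofPred_eq]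
      at he he'
    dsimp only at heq
    have key : ∀ u v, c u = c v → α u = α v → u = v := fun u v hc hα => by
      by_contra hne
      exact h u v hne hc hα
    split_ifs at heq <;> simp only [Sigma.mk.injEq, heq_eq_eq] at heq <;>
      obtain ⟨rfl, hα⟩ := heq
    · rw [key a a' (by omega) hα]
    · have := key a b' (by omega) hα
      omega
    · have := key b a' (by omega) hα
      omega
    · rw [key b b' (by omega) hα]

/-- Antisymmetrization kills `s * f` if `s` is invariant under the permutations preserving `c`
and `f` has small degree. -/
lemma sum_sign_mul_rename_eq_zero {c : Fin m → ℕ} {s f : MvPolynomial (Fin m) K}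
    (hs : ∀ π : Equiv.Perm (Fin m), (∀ i, c (π i) = c i) → rename π s = s)
    (hf : f.totalDegree < (fiberPairs c).card) :
    ∑ π : Equiv.Perm (Fin m),
      ((Equiv.Perm.sign π : ℤ) : MvPolynomial (Fin m) K) * rename π (s * f) = 0 := by
  have hmono : ∀ α ∈ f.support, ∑ π : Equiv.Perm (Fin m),
      ((Equiv.Perm.sign π : ℤ) : MvPolynomial (Fin m) K) *
        rename π (s * monomial α (coeff α f)) = 0 := by
    intro α hα
    have hdeg : ∑ i, α i ≤ f.totalDegree := by
      simpa [Finsupp.sum_fintype] using le_totalDegree hα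
    obtain ⟨a, b, hab, hc, hαab⟩ : ∃ a b, a ≠ b ∧ c a = c b ∧ α a = α b := by
      by_contra! h
      exact absurd (card_fiberPairs_le_sum h) (by omega)
    have hswap : ∀ w : Fin m → ℕ, w a = w b → ∀ i, w (Equiv.swap a b i) = w i := by
      intro w hw i
      rw [Equiv.swap_apply_def]
      split_ifs <;> simp_all
    have hα' : α.mapDomain (Equiv.swap a b) = α := by
      ext i
      rw [Finsupp.mapDomain_equiv_apply, Equiv.symm_swap, hswap α hαab]
    have hinv : rename (Equiv.swap a b) (s * monomial α (coeff α f)) =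
        s * monomial α (coeff α f) := by
      rw [map_mul, hs _ (hswap c hc), rename_monomial, hα']
    refine Finset.sum_involution (fun π _ => π * Equiv.swap a b) ?_ ?_ (by simp) (by simp)
    · intro π _
      rw [Equiv.Perm.sign_mul, Equiv.Perm.sign_swap hab, Equiv.Perm.coe_mul, ← rename_rename,
        hinv]
      simp
    · intro π _ _ h
      exact hab (Equiv.swap_eq_one_iff.mp (mul_eq_left.mp h))
  conv_lhs => rw [f.as_sum]
  simp_rw [Finset.mul_sum, map_sum, Finset.mul_sum]
  rw [Finset.sum_comm]
  exact Finset.sum_eq_zero hmono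

/-- The product over `crossPairs c` is invariant under the permutations preserving `c`. -/
lemma rename_prod_crossPairs {c : Fin m → ℕ} {π : Equiv.Perm (Fin m)}
    (hπ : ∀ i, c (π i) = c i) :
    rename π (∏ e ∈ crossPairs c, (X e.1 - X e.2) : MvPolynomial (Fin m) K) =
      ∏ e ∈ crossPairs c, (X e.1 - X e.2) := by
  rw [map_prod]
  refine Finset.prod_equiv (π.prodCongr π) ?_ ?_
  · simp [crossPairs, hπ]
  · simp

lemma differenceProduct_eq_mul {c : Fin m → ℕ} (hc : Monotone c) :
    differenceProduct K m =
      (∏ e ∈ fiberPairs c, (X e.1 - X e.2)) * ∏ e ∈ crossPairs c, (X e.1 - X e.2) := by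
  rw [← Finset.prod_union]
  · refine Finset.prod_congr ?_ fun _ _ => rfl
    ext ⟨a, b⟩
    simp only [fiberPairs, crossPairs, Finset.mem_filter, Finset.mem_univ, true_and,
      Finset.mem_union]
    constructor
    · intro h
      rcases (hc h.le).lt_or_eq with h' | h'
      exacts [.inr h', .inl ⟨h, h'⟩]
    · rintro (h | h)
      exacts [h.1, hc.reflect_lt h]
  · rw [Finset.disjoint_left]
    intro e he he'
    simp only [fiberPairs, crossPairs, Finset.mem_filter] at he he'
    omega

/-- Divided symmetrization over edges inside the fibres of `c` kills `s * f` if `s` is invariant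
under the permutations preserving `c` and the degree of `f` is less than the number of edges. -/
lemma DS_mul_eq_zero {c : Fin m → ℕ} (hc : Monotone c) {E : Finset (Fin m × Fin m)}
    (hE : E ⊆ fiberPairs c) {s f : MvPolynomial (Fin m) K}
    (hs : ∀ π : Equiv.Perm (Fin m), (∀ i, c (π i) = c i) → rename π s = s)
    (hf : f.totalDegree < E.card) : DS E (s * f) = 0 := by
  set P : MvPolynomial (Fin m) K := ∏ e ∈ E, (X e.1 - X e.2)
  set Q : MvPolynomial (Fin m) K := ∏ e ∈ fiberPairs c \ E, (X e.1 - X e.2)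
  set C : MvPolynomial (Fin m) K := ∏ e ∈ crossPairs c, (X e.1 - X e.2)
  have hV : differenceProduct K m = P * (Q * C) := by
    rw [differenceProduct_eq_mul hc, ← Finset.prod_sdiff hE]
    ring
  have hQ : Q.totalDegree ≤ (fiberPairs c \ E).card := by
    refine (totalDegree_finsetProd _ _).trans ?_
    rw [Finset.card_eq_sum_ones]
    refine Finset.sum_le_sum fun e _ => (totalDegree_sub _ _).trans ?_
    simp
  have hdeg : (f * Q).totalDegree < (fiberPairs c).card := by
    have := totalDegree_mul f Q
    have := Finset.card_sdiff_add_card_eq_card hE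
    omega
  have hsC : ∀ π : Equiv.Perm (Fin m), (∀ i, c (π i) = c i) → rename π (s * C) = s * C :=
    fun π hπ => by rw [map_mul, hs π hπ, rename_prod_crossPairs hπ]
  have hren : ∀ (π : Equiv.Perm (Fin m)) {p : MvPolynomial (Fin m) K}, p ≠ 0 →
      algebraMap _ (FractionRing (MvPolynomial (Fin m) K)) (rename π p) ≠ 0 := by
    intro π p hp h
    rw [FaithfulSMul.algebraMap_eq_zero_iff] at h
    exact hp (rename_injective π π.injective (by simpa using h))
  have hterm : ∀ π : Equiv.Perm (Fin m),
      algebraMap _ (FractionRing (MvPolynomial (Fin m) K)) (rename π (s * f)) /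
        algebraMap _ _ (rename π P) =
      algebraMap _ _ (((Equiv.Perm.sign π : ℤ) : MvPolynomial (Fin m) K) *
        rename π (s * C * (f * Q))) / algebraMap _ _ (differenceProduct K m) := by
    intro π
    have hsign : (((Equiv.Perm.sign π : ℤ) : MvPolynomial (Fin m) K)) *
        ((Equiv.Perm.sign π : ℤ) : MvPolynomial (Fin m) K) = 1 := by
      rw [← Int.cast_mul, ← Units.val_mul, Int.units_mul_self]
      simp
    have hV' : differenceProduct K m =
        ((Equiv.Perm.sign π : ℤ) : MvPolynomial (Fin m) K) *
          rename π (differenceProduct K m) := by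
      rw [rename_differenceProduct, ← mul_assoc, hsign, one_mul]
    have hV0 := (FaithfulSMul.algebraMap_eq_zero_iff (MvPolynomial (Fin m) K)
      (FractionRing (MvPolynomial (Fin m) K))).not.mpr
        (differenceProduct_ne_zero (K := K) (m := m))
    have hP : P ≠ 0 := fun h => differenceProduct_ne_zero (K := K) (m := m) (by simp [hV, h])
    rw [div_eq_div_iff (hren π hP) hV0, ← map_mul, ← map_mul, hV', hV]
    congr 1
    simp only [map_mul]
    ring
  rw [DS, Finset.sum_congr rfl fun π _ => hterm π, ← Finset.sum_div, ← map_sum,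
    sum_sign_mul_rename_eq_zero hsC hdeg, map_zero, zero_div]

lemma pathEdges_subset_fiberPairs (n : ℕ) : pathEdges n ⊆ fiberPairs fun _ => 0 := by
  intro e he
  obtain ⟨i, -, rfl⟩ := Finset.mem_image.mp he
  simp [fiberPairs]

lemma card_pathEdges (n : ℕ) : (pathEdges n).card = n := by
  rw [pathEdges, Finset.card_image_of_injective, Finset.card_univ, Fintype.card_fin]
  intro i j h
  exact Fin.castSucc_injective n (congrArg Prod.fst h)

lemma rename_pathY {n : ℕ} {k : Fin (n + 1)} {π : Equiv.Perm (Fin (n + 1))}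
    (hπ : ∀ i, π i ≤ k ↔ i ≤ k) : rename π (pathY n K k) = pathY n K k := by
  rw [pathY, map_sum]
  refine Finset.sum_equiv π ?_ ?_
  · simp [hπ]
  · simp

/-- A factor of `f` attached to an edge cancels that edge. -/
lemma DS_edge_mul {E : Finset (Fin m × Fin m)} {e : Fin m × Fin m} (he : e ∈ E)
    (hne : e.1 ≠ e.2) (f : MvPolynomial (Fin m) K) :
    DS E ((X e.1 - X e.2) * f) = DS (E.erase e) f := by
  refine Finset.sum_congr rfl fun π _ => ?_
  rw [← Finset.mul_prod_erase E _ he, map_mul, map_mul, map_mul, map_mul]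
  refine mul_div_mul_left _ _ fun h => ?_
  rw [FaithfulSMul.algebraMap_eq_zero_iff, map_sub, rename_X, rename_X, sub_eq_zero] at h
  exact hne (π.injective (X_injective h))

end

/-- for the path `G` on `x_0, …, x_n`, `Φ = DS_G`, and
`y_i = x_0 + ⋯ + x_i`: for any polynomial `g` of degree `n − 1`, `Φ(y_n · g) = 0`,
and for any `0 ≤ k ≤ n − 1` and any polynomial `g` of degree `n − 2`,
`Φ(y_k · (x_{k+1} − x_k) · g) = 0`. -/
theorem path_kernel_elements {K : Type*} [Field K] [CharZero K] (n : ℕ) :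
    (∀ g : MvPolynomial (Fin (n + 1)) K, g.totalDegree + 1 = n →
      DS (pathEdges n) (pathY n K (Fin.last n) * g) = 0) ∧
    (∀ k : Fin n, ∀ g : MvPolynomial (Fin (n + 1)) K, g.totalDegree + 2 = n →
      DS (pathEdges n)
        (pathY n K k.castSucc * (X k.succ - X k.castSucc) * g) = 0) := by
  constructor
  · intro g hg
    refine DS_mul_eq_zero monotone_const (pathEdges_subset_fiberPairs n)
      (fun π _ => rename_pathY fun i => by simp [Fin.le_last]) ?_
    rw [card_pathEdges]
    omega
  · intro k g hg
    have he : (k.castSucc, k.succ) ∈ pathEdges n := Finset.mem_image_of_mem _ (Finset.mem_univ k)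
    have hmul : pathY n K k.castSucc * (X k.succ - X k.castSucc) * g =
        (X k.castSucc - X k.succ) * (pathY n K k.castSucc * -g) := by ring
    rw [hmul, DS_edge_mul he k.castSucc_lt_succ.ne]
    refine DS_mul_eq_zero (c := fun i => if i ≤ k.castSucc then 0 else 1) ?_ ?_
      (fun π hπ => rename_pathY fun i => ?_) ?_
    · intro i j hij
      dsimp only
      split_ifs <;> omega
    · intro e he'
      obtain ⟨hne, he'⟩ := Finset.mem_erase.mp he'
      obtain ⟨i, -, rfl⟩ := Finset.mem_image.mp he'
      have hik : i ≠ k := by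
        rintro rfl
        exact hne rfl
      have : i.castSucc ≤ k.castSucc ↔ i.succ ≤ k.castSucc := by
        simp only [Fin.le_def, Fin.val_castSucc, Fin.val_succ]
        omega
      simp [fiberPairs, ← this]
    · have := hπ i
      split_ifs at this <;> grind
    · rw [totalDegree_neg, Finset.card_erase_of_mem he, card_pathEdges]
      omega
end

section
/- (Theorem 2, Postnikov-type identity) Let G be the path on the ordered variable set V = {x_0, x_1, ..., x_n} with edges (x_i, x_{i+1}), 0 ≤ i ≤ n−1, let Φ = DS_G, and set y_i = x_0 + x_1 + ... + x_i. For any homogeneous polynomial h(t_0, ..., t_n) of degree n in n+1 variables, Φ( h(y_0, y_1, ..., y_n) + h(y_1, y_2, ..., y_n, y_0) + ... + h(y_n, y_0, ..., y_{n−1}) ) = n! · h(1, 1, ..., 1), where the sum inside Φ is over all n+1 cyclic shifts of the argument list (y_0, ..., y_n). -/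
open MvPolynomial

theorem Fin.val_nsmul_one {n : ℕ} (i : Fin (n + 1)) : i.val • (1 : Fin (n + 1)) = i := by
  refine Fin.induction (by simp) (fun j hj => ?_) i
  rw [Fin.val_succ, succ_nsmul, ← Fin.val_castSucc, hj, Fin.coeSucc_eq_succ]

open Finsupp in
theorem exists_card_support_lt_of_topple {n : ℕ} {S : Set (Fin (n + 1) →₀ ℕ)}
    (hS : ∀ d i, d + single i 2 ∈ S → d + single i 1 + single (i + 1) 1 ∈ S) (k : ℕ) :
    ∀ c ∈ S, ∀ i : Fin (n + 1), 2 ≤ c i → c (i + k • 1) = 0 →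
      ∃ c' ∈ S, c.support.card < c'.support.card := by
  induction k with
  | zero => intro c _ i h2 h0; simp at h0; omega
  | succ k ih =>
    intro c hc i h2 h0
    obtain ⟨d, rfl⟩ : ∃ d, c = d + single i 2 := by
      refine ⟨c - single i 2, (tsub_add_cancel_of_le ?_).symm⟩
      simpa using h2
    have hc' := hS d i hc
    by_cases h1 : (d + single i 2 : Fin (n + 1) →₀ ℕ) (i + 1) = 0
    · refine ⟨_, hc', Finset.card_lt_card ?_⟩
      rw [Finset.ssubset_iff_of_subset]
      · exact ⟨i + 1, by simp, by simpa using h1⟩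
      · intro j hj
        simp [single_apply] at hj ⊢
        grind
    · have hsupp : (d + single i 1 + single (i + 1) 1).support = (d + single i 2).support := by
        ext j
        simp [single_apply] at h1 ⊢
        grind
      rw [← hsupp]
      refine ih _ hc' (i + 1) ?_ ?_
      · simp [single_apply] at h1 ⊢
        grind
      · have e : i + 1 + k • (1 : Fin (n + 1)) = i + (k + 1) • (1 : Fin (n + 1)) := by
          rw [succ_nsmul']; abel
        rw [e]
        generalize i + (k + 1) • (1 : Fin (n + 1)) = j at h0
        simp [single_apply] at h0 h1 ⊢
        grind

open Finsupp in
theorem le_of_topple_mean {n : ℕ} {F : (Fin (n + 1) →₀ ℕ) → ℚ} {a : ℚ}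
    (hF : ∀ d i, d.degree + 2 = n → 2 * F (d + single i 2) =
      F (d + single i 1 + single (i - 1) 1) + F (d + single i 1 + single (i + 1) 1))
    (ha : ∀ c, c.degree = n → (∀ i, c i ≤ 1) → F c = a)
    (c : Fin (n + 1) →₀ ℕ) (hc : c.degree = n) : F c ≤ a := by
  have hmem : ∀ c : Fin (n + 1) →₀ ℕ,
      c ∈ Finset.univ.finsuppAntidiag n ↔ c.degree = n := by
    simp [Finset.mem_finsuppAntidiag, Finsupp.degree_eq_sum]
  obtain ⟨m, hm, hmax⟩ := Finset.exists_max_image (Finset.univ.finsuppAntidiag n) F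
    ⟨c, (hmem c).2 hc⟩
  simp only [hmem] at hm hmax
  let S : Set (Fin (n + 1) →₀ ℕ) := {e | e.degree = n ∧ F e = F m}
  have hS : ∀ d i, d + single i 2 ∈ S → d + single i 1 + single (i + 1) 1 ∈ S := by
    rintro d i ⟨h1, h2⟩
    simp only [map_add, degree_single] at h1
    have e1 := hmax (d + single i 1 + single (i - 1) 1) (by simp [degree_single]; omega)
    have h3 : (d + single i 1 + single (i + 1) 1).degree = n := by simp [degree_single]; omega
    have e2 := hmax _ h3
    have e3 := hF d i h1
    exact ⟨h3, by linarith⟩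
  obtain ⟨s, ⟨hs, hsF⟩, hsmax⟩ := Set.Finite.exists_maximalFor
    (fun e : Fin (n + 1) →₀ ℕ => e.support.card) S
    ((Finset.finite_toSet (Finset.univ.finsuppAntidiag n)).subset fun e he => by
      simpa only [Finset.mem_coe, hmem] using he.1) ⟨m, hm, rfl⟩
  refine (hmax c hc).trans (hsF ▸ (ha s hs ?_).le)
  by_contra! ⟨i, hi⟩
  obtain ⟨j, hj⟩ : ∃ j, s j = 0 := by
    by_contra! h
    have := Finset.sum_le_sum (s := Finset.univ) fun j _ => Nat.one_le_iff_ne_zero.2 (h j)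
    simp [← Finsupp.degree_eq_sum, hs] at this
  obtain ⟨c', hc', hlt⟩ := exists_card_support_lt_of_topple hS (j - i).val s ⟨hs, hsF⟩ i hi
    (by rw [Fin.val_nsmul_one, add_sub_cancel, hj])
  exact absurd (hsmax hc' hlt.le) (by simpa using hlt)

open Finsupp in
/-- A function on the configurations of `n` chips on a cycle of length `n + 1` is constant if it is
constant on the stable configurations and its value is the mean of its values at the two
configurations obtained by moving a chip out of a multiply occupied site. -/
theorem eq_of_topple_mean {n : ℕ} {V : Type*} [AddCommGroup V] [Module ℚ V]
    {F : (Fin (n + 1) →₀ ℕ) → V} {a : V}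
    (hF : ∀ d i, d.degree + 2 = n → F (d + single i 2) + F (d + single i 2) =
      F (d + single i 1 + single (i - 1) 1) + F (d + single i 1 + single (i + 1) 1))
    (ha : ∀ c, c.degree = n → (∀ i, c i ≤ 1) → F c = a)
    (c : Fin (n + 1) →₀ ℕ) (hc : c.degree = n) : F c = a := by
  rw [← sub_eq_zero, ← Module.forall_dual_apply_eq_zero_iff ℚ]
  have key : ∀ φ : Module.Dual ℚ V, φ (F c) ≤ φ a := fun φ => by
    refine le_of_topple_mean (F := fun c => φ (F c)) (fun d i h => ?_)
      (fun c h h' => by rw [ha c h h']) c hc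
    simpa [two_mul] using congrArg φ (hF d i h)
  intro φ
  rw [map_sub, sub_eq_zero]
  exact le_antisymm (key φ) (by simpa using key (-φ))

theorem card_monochromatic_le_sum {m : ℕ} {κ d : Fin m → ℕ}
    (hd : ∀ a b, κ a = κ b → d a = d b → a = b) :
    (Finset.univ.filter fun p : Fin m × Fin m => p.1 < p.2 ∧ κ p.1 = κ p.2).card ≤ ∑ i, d i := by
  have : ∑ i, d i = (Finset.univ.sigma fun i => Finset.range (d i)).card := by simp
  rw [this]
  refine Finset.card_le_card_of_injOn
    (fun p => if d p.1 < d p.2 then ⟨p.2, d p.1⟩ else ⟨p.1, d p.2⟩) ?_ ?_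
  · rintro ⟨a, b⟩ h
    simp at h
    have := hd a b h.2
    dsimp only
    split_ifs with h1
    · simpa using h1
    · simp
      grind
  · rintro ⟨a, b⟩ h ⟨a', b'⟩ h' he
    simp at h h'
    dsimp only at he
    split_ifs at he <;> simp only [Sigma.mk.injEq, heq_eq_eq] at he <;>
      obtain ⟨rfl, he⟩ := he
    · rw [hd a a' (h.2.trans h'.2.symm) he]
    · have := hd a b' (by rw [h.2, h'.2]) he
      subst this
      exact absurd h.1 (not_lt.2 h'.1.le)
    · have := hd b a' (by rw [← h.2, ← h'.2]) he
      subst this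
      exact absurd h.1 (not_lt.2 h'.1.le)
    · rw [hd b b' (by rw [← h.2, ← h'.2]) he]

section Vanishing

variable {K : Type*} [Field K] {m : ℕ}

/-- The permutations of `Fin m` that preserve every colour class of `κ`. -/
def colourPerms (κ : Fin m → ℕ) : Finset (Equiv.Perm (Fin m)) :=
  Finset.univ.filter fun τ => ∀ a, κ (τ a) = κ a

theorem mem_colourPerms {κ : Fin m → ℕ} {τ : Equiv.Perm (Fin m)} :
    τ ∈ colourPerms κ ↔ ∀ a, κ (τ a) = κ a := by
  simp [colourPerms]

/-- The antisymmetrization of `q` over the permutations preserving the colouring `κ`. -/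
noncomputable def colourAntisym (κ : Fin m → ℕ) (q : MvPolynomial (Fin m) K) :
    MvPolynomial (Fin m) K :=
  ∑ τ ∈ colourPerms κ, ((Equiv.Perm.sign τ : ℤ) : MvPolynomial (Fin m) K) * rename τ q

theorem totalDegree_intCast_mul_le (z : ℤ) (q : MvPolynomial (Fin m) K) :
    ((z : MvPolynomial (Fin m) K) * q).totalDegree ≤ q.totalDegree := by
  refine (totalDegree_mul _ _).trans ?_
  rw [← map_intCast (C : K →+* MvPolynomial (Fin m) K), totalDegree_C, zero_add]

theorem rename_swap_colourAntisym {κ : Fin m → ℕ} (q : MvPolynomial (Fin m) K) {a b : Fin m}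
    (hab : a ≠ b) (hκ : κ a = κ b) :
    rename (Equiv.swap a b) (colourAntisym κ q) = -colourAntisym κ q := by
  have hswap : ∀ c, κ (Equiv.swap a b c) = κ c := fun c => by
    rw [Equiv.swap_apply_def]; grind
  simp only [colourAntisym, map_sum, ← Finset.sum_neg_distrib]
  refine Finset.sum_equiv (Equiv.mulLeft (Equiv.swap a b)) (fun τ => ?_) (fun τ _ => ?_)
  · simp [mem_colourPerms, hswap]
  · simp [rename_rename, Equiv.Perm.sign_swap hab, Equiv.Perm.coe_mul]

theorem colourAntisym_eq_zero [CharZero K] {κ : Fin m → ℕ} {q : MvPolynomial (Fin m) K}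
    (hq : q.totalDegree <
      (Finset.univ.filter fun p : Fin m × Fin m => p.1 < p.2 ∧ κ p.1 = κ p.2).card) :
    colourAntisym κ q = 0 := by
  ext d
  rw [coeff_zero]
  by_cases hd : ∀ a b, κ a = κ b → d a = d b → a = b
  · refine coeff_eq_zero_of_totalDegree_lt ?_
    have h1 : (colourAntisym κ q).totalDegree ≤ q.totalDegree := by
      refine totalDegree_finsetSum_le fun τ _ => ?_
      exact (totalDegree_intCast_mul_le _ _).trans (totalDegree_rename_le _ _)
    have h2 := card_monochromatic_le_sum hd
    have h3 : ∑ i ∈ d.support, d i = ∑ i, d i :=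
      Finset.sum_subset (Finset.subset_univ _) (by simp)
    omega
  · push Not at hd
    obtain ⟨a, b, hκ, hdab, hab⟩ := hd
    have h1 : Finsupp.mapDomain (Equiv.swap a b) d = d := by
      ext c
      rw [Finsupp.mapDomain_equiv_apply, Equiv.symm_swap, Equiv.swap_apply_def]
      grind
    have h2 := coeff_rename_mapDomain _ (Equiv.swap a b).injective (colourAntisym κ q) d
    rw [h1, rename_swap_colourAntisym q hab hκ, coeff_neg] at h2
    exact self_eq_neg.1 h2.symm

/-- The factor of `colourVandermonde` attached to a pair of variables. -/
noncomputable def colourFactor (κ : Fin m → ℕ) (i j : Fin m) : MvPolynomial (Fin m) K :=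
  if κ i = κ j then X i - X j else if κ i < κ j then 1 else -1

theorem colourFactor_antisymm (κ : Fin m → ℕ) (i j : Fin m) :
    (colourFactor κ i j : MvPolynomial (Fin m) K) = -colourFactor κ j i := by
  unfold colourFactor
  rcases lt_trichotomy (κ i) (κ j) with h | h | h
  · simp [h, h.ne, h.ne', h.not_gt]
  · simp [h]
  · simp [h, h.ne, h.ne', h.not_gt]

theorem rename_colourFactor {κ : Fin m → ℕ} {τ : Equiv.Perm (Fin m)} (hτ : τ ∈ colourPerms κ)
    (i j : Fin m) :
    rename τ (colourFactor κ i j : MvPolynomial (Fin m) K) = colourFactor κ (τ i) (τ j) := by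
  rw [mem_colourPerms] at hτ
  unfold colourFactor
  rw [hτ, hτ]
  split_ifs <;> simp

theorem totalDegree_colourFactor_le (κ : Fin m → ℕ) (i j : Fin m) :
    (colourFactor κ i j : MvPolynomial (Fin m) K).totalDegree ≤ if κ i = κ j then 1 else 0 := by
  unfold colourFactor
  split_ifs
  · exact (totalDegree_sub _ _).trans (by simp)
  · simp
  · simp

/-- The product, up to sign, of the Vandermonde products of the colour classes of `κ`. -/
noncomputable def colourVandermonde (κ : Fin m → ℕ) : MvPolynomial (Fin m) K :=
  ∏ p : Fin m × Fin m with p.1 < p.2, colourFactor κ p.1 p.2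

theorem colourVandermonde_ne_zero (κ : Fin m → ℕ) :
    (colourVandermonde κ : MvPolynomial (Fin m) K) ≠ 0 := by
  rw [colourVandermonde, Finset.prod_ne_zero_iff]
  rintro ⟨a, b⟩ h
  simp at h
  unfold colourFactor
  split_ifs
  · exact sub_ne_zero.2 fun e => h.ne (X_injective e)
  · simp
  · simp

theorem rename_colourVandermonde {κ : Fin m → ℕ} {τ : Equiv.Perm (Fin m)}
    (hτ : τ ∈ colourPerms κ) :
    rename τ (colourVandermonde κ : MvPolynomial (Fin m) K) =
      ((Equiv.Perm.sign τ : ℤ) : MvPolynomial (Fin m) K) * colourVandermonde κ := by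
  have h : ∀ f : Fin m → Fin m → MvPolynomial (Fin m) K,
      ∏ p : Fin m × Fin m with p.1 < p.2, f p.1 p.2 = ∏ i, ∏ j > i, f i j := fun f => by
    rw [Finset.prod_filter, Fintype.prod_prod_type]
    refine Finset.prod_congr rfl fun i _ => ?_
    rw [← Finset.prod_filter]
    refine Finset.prod_congr (by ext; simp) fun _ _ => rfl
  rw [colourVandermonde, map_prod, h, ← Equiv.Perm.prod_Ioi_comp_eq_sign_mul_prod τ
    (colourFactor_antisymm κ), ← h (fun i j => colourFactor κ (τ i) (τ j))]
  exact Finset.prod_congr rfl fun p _ => rename_colourFactor hτ _ _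

theorem exists_mul_eq_colourVandermonde {κ : Fin m → ℕ} {E : Finset (Fin m × Fin m)}
    (hE : ∀ e ∈ E, e.1 < e.2 ∧ κ e.1 = κ e.2) :
    ∃ P : MvPolynomial (Fin m) K, P * ∏ e ∈ E, (X e.1 - X e.2) = colourVandermonde κ ∧
      P.totalDegree + E.card ≤
        (Finset.univ.filter fun p : Fin m × Fin m => p.1 < p.2 ∧ κ p.1 = κ p.2).card := by
  have hsub : E ⊆ Finset.univ.filter fun p : Fin m × Fin m => p.1 < p.2 := fun e he => by
    simpa using (hE e he).1
  have hsub' : E ⊆ Finset.univ.filter fun p : Fin m × Fin m => p.1 < p.2 ∧ κ p.1 = κ p.2 :=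
    fun e he => by simpa using hE e he
  refine ⟨∏ p ∈ (Finset.univ.filter fun p : Fin m × Fin m => p.1 < p.2) \ E,
    colourFactor κ p.1 p.2, ?_, ?_⟩
  · rw [colourVandermonde, ← Finset.prod_sdiff hsub]
    congr 1
    exact Finset.prod_congr rfl fun e he => by rw [colourFactor, if_pos (hE e he).2]
  · rw [← Finset.card_sdiff_add_card_eq_card hsub', add_le_add_iff_right]
    refine (totalDegree_finsetProd _ _).trans
      ((Finset.sum_le_sum fun p _ => totalDegree_colourFactor_le κ p.1 p.2).trans ?_)
    rw [← Finset.card_filter]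
    refine Finset.card_le_card fun p => ?_
    simp
    tauto

/-- Divided symmetrization kills `s * g` when `g` has degree less than the number of edges and `s`
is invariant under the permutations preserving a colouring for which all edges are
monochromatic. -/
theorem DS_mul_eq_zero_s12 [CharZero K] {κ : Fin m → ℕ} {E : Finset (Fin m × Fin m)}
    (hE : ∀ e ∈ E, e.1 < e.2 ∧ κ e.1 = κ e.2) {s g : MvPolynomial (Fin m) K}
    (hs : ∀ τ ∈ colourPerms κ, rename τ s = s) (hg : g.totalDegree < E.card) :
    DS E (s * g) = 0 := by
  obtain ⟨P, hP, hdeg⟩ := exists_mul_eq_colourVandermonde (K := K) hE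
  have hzero : colourAntisym κ (g * P) = 0 :=
    colourAntisym_eq_zero ((totalDegree_mul _ _).trans_lt (by omega))
  set D : MvPolynomial (Fin m) K := ∏ e ∈ E, (X e.1 - X e.2)
  set ι := algebraMap (MvPolynomial (Fin m) K) (FractionRing (MvPolynomial (Fin m) K))
  have hι : Function.Injective ι := IsFractionRing.injective _ _
  have hne : ∀ (π : Equiv.Perm (Fin m)) {q : MvPolynomial (Fin m) K}, q ≠ 0 →
      ι (rename π q) ≠ 0 := fun π q hq => by
    rwa [Ne, map_eq_zero_iff ι hι, map_eq_zero_iff _ (rename_injective _ π.injective)]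
  have hD0 : D ≠ 0 := fun h => colourVandermonde_ne_zero (K := K) κ (by rw [← hP, h, mul_zero])
  have hterm : ∀ π, ∀ τ ∈ colourPerms κ,
      ι (rename (π * τ : Equiv.Perm (Fin m)) (s * g)) / ι (rename (π * τ : Equiv.Perm (Fin m)) D) =
        ι (rename π (s * (((Equiv.Perm.sign τ : ℤ) : MvPolynomial (Fin m) K) *
          rename τ (g * P)))) / ι (rename π (colourVandermonde κ)) := by
    intro π τ hτ
    rw [div_eq_div_iff (hne _ hD0) (hne _ (colourVandermonde_ne_zero κ)), ← map_mul, ← map_mul,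
      Equiv.Perm.coe_mul, ← rename_rename, ← rename_rename, ← map_mul, ← map_mul]
    congr 2
    have hV := rename_colourVandermonde (K := K) hτ
    have hsq : ((Equiv.Perm.sign τ : ℤ) : MvPolynomial (Fin m) K) *
        ((Equiv.Perm.sign τ : ℤ) : MvPolynomial (Fin m) K) = 1 := by
      rw [← Int.cast_mul, ← Units.val_mul, Int.units_mul_self]; simp
    rw [← hP, map_mul] at hV
    rw [map_mul, map_mul, hs τ hτ, ← hP]
    linear_combination (-((Equiv.Perm.sign τ : ℤ) : MvPolynomial (Fin m) K) * s * rename τ g) * hV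
      - s * rename τ g * P * D * hsq
  have havg : ∑ τ ∈ colourPerms κ, DS E (s * g) = 0 := by
    have h : ∀ τ ∈ colourPerms κ, DS E (s * g) = ∑ π,
        ι (rename (π * τ : Equiv.Perm (Fin m)) (s * g)) /
          ι (rename (π * τ : Equiv.Perm (Fin m)) D) := fun τ _ =>
      (Equiv.sum_comp (Equiv.mulRight τ) fun π : Equiv.Perm (Fin m) =>
        ι (rename π (s * g)) / ι (rename π D)).symm
    rw [Finset.sum_congr rfl h, Finset.sum_comm]
    refine Finset.sum_eq_zero fun π _ => ?_
    rw [Finset.sum_congr rfl (hterm π), ← Finset.sum_div, ← map_sum, ← map_sum, ← Finset.mul_sum]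
    change ι (rename π (s * colourAntisym κ (g * P))) / _ = 0
    rw [hzero, mul_zero, map_zero, map_zero, zero_div]
  rw [Finset.sum_const, nsmul_eq_mul, mul_eq_zero, Nat.cast_eq_zero, Finset.card_eq_zero] at havg
  refine havg.resolve_left (Finset.Nonempty.ne_empty ⟨1, ?_⟩)
  simp [mem_colourPerms]

end Vanishing

section Linearity

variable {K : Type*} [Field K] {m : ℕ} (E : Finset (Fin m × Fin m))

theorem DS_add (f g : MvPolynomial (Fin m) K) : DS E (f + g) = DS E f + DS E g := by
  simp [DS, add_div, Finset.sum_add_distrib]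

theorem DS_C_mul (a : K) (f : MvPolynomial (Fin m) K) :
    DS E (C a * f) = algebraMap (MvPolynomial (Fin m) K) (FractionRing (MvPolynomial (Fin m) K))
      (C a) * DS E f := by
  simp [DS, mul_div_assoc, Finset.mul_sum]

/-- `DS E` as an additive homomorphism. -/
noncomputable def dsHom : MvPolynomial (Fin m) K →+ FractionRing (MvPolynomial (Fin m) K) :=
  AddMonoidHom.mk' (DS E) (DS_add E)

theorem DS_sum {α : Type*} (s : Finset α) (f : α → MvPolynomial (Fin m) K) :
    DS E (∑ i ∈ s, f i) = ∑ i ∈ s, DS E (f i) :=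
  map_sum (dsHom E) f s

theorem DS_sub (f g : MvPolynomial (Fin m) K) : DS E (f - g) = DS E f - DS E g :=
  map_sub (dsHom E) f g

theorem DS_natCast_mul (a : ℕ) (f : MvPolynomial (Fin m) K) :
    DS E ((a : MvPolynomial (Fin m) K) * f) =
    (a : FractionRing (MvPolynomial (Fin m) K)) * DS E f := by
  rw [← nsmul_eq_mul, ← nsmul_eq_mul]
  exact map_nsmul (dsHom E) a f

/-- Multiplication by the difference attached to an edge deletes this edge. -/
theorem DS_sub_mul {E : Finset (Fin m × Fin m)} {a b : Fin m} (hab : a ≠ b) (he : (a, b) ∈ E)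
    (f : MvPolynomial (Fin m) K) : DS E ((X a - X b) * f) = DS (E.erase (a, b)) f := by
  refine Finset.sum_congr rfl fun π _ => ?_
  rw [← Finset.mul_prod_erase E _ he, map_mul, map_mul, map_mul, map_mul]
  refine mul_div_mul_left _ _ ?_
  rw [Ne, map_eq_zero_iff _ (IsFractionRing.injective _ _),
    map_eq_zero_iff _ (rename_injective _ π.injective), sub_eq_zero]
  exact fun h => hab (X_injective h)

theorem DS_empty_one : DS ∅ (1 : MvPolynomial (Fin m) K) = (m.factorial : ℕ) := by
  simp [DS, Fintype.card_perm]

end Linearity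

section Path

variable {n : ℕ} {K : Type*} [Field K]

/-- The edges `(x_i, x_{i+1})` of the path with `i` in `s`. -/
def subpathEdges (s : Finset (Fin n)) : Finset (Fin (n + 1) × Fin (n + 1)) :=
  s.image fun i => (i.castSucc, i.succ)

theorem subpathEdges_univ : subpathEdges (Finset.univ : Finset (Fin n)) = pathEdges n := rfl

theorem edge_injective : Function.Injective fun i : Fin n => (i.castSucc, i.succ) :=
  fun _ _ h => Fin.castSucc_injective _ (congrArg Prod.fst h)

theorem card_subpathEdges (s : Finset (Fin n)) : (subpathEdges s).card = s.card :=
  Finset.card_image_of_injective _ edge_injective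

theorem subpathEdges_erase (s : Finset (Fin n)) (i : Fin n) :
    (subpathEdges s).erase (i.castSucc, i.succ) = subpathEdges (s.erase i) :=
  (Finset.image_erase edge_injective s i).symm

theorem DS_subpathEdges_sub_mul {s : Finset (Fin n)} {i : Fin n} (hi : i ∈ s)
    (f : MvPolynomial (Fin (n + 1)) K) :
    DS (subpathEdges s) ((X i.castSucc - X i.succ) * f) = DS (subpathEdges (s.erase i)) f := by
  have he : (i.castSucc, i.succ) ∈ subpathEdges s := Finset.mem_image_of_mem _ hi
  rw [DS_sub_mul (Fin.castSucc_lt_succ).ne he, subpathEdges_erase]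

theorem totalDegree_pathY_le (k : Fin (n + 1)) : (pathY n K k).totalDegree ≤ 1 :=
  totalDegree_finsetSum_le fun _ _ => (totalDegree_X _).le

theorem totalDegree_prod_pathY_le {α : Type*} (s : Finset α) (f : α → Fin (n + 1)) :
    (∏ i ∈ s, pathY n K (f i)).totalDegree ≤ s.card := by
  refine (totalDegree_finsetProd _ _).trans ?_
  simpa using Finset.sum_le_sum fun i (_ : i ∈ s) => totalDegree_pathY_le (K := K) (f i)

theorem DS_pathY_mul_eq_zero [CharZero K] {s : Finset (Fin n)} (c : Fin (n + 1))
    (hc : ∀ i ∈ s, i.castSucc ≠ c) {g : MvPolynomial (Fin (n + 1)) K}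
    (hg : g.totalDegree < s.card) : DS (subpathEdges s) (pathY n K c * g) = 0 := by
  refine DS_mul_eq_zero_s12 (κ := fun a => if a ≤ c then 0 else 1) ?_ ?_
    (by rwa [card_subpathEdges])
  · intro e he
    obtain ⟨i, hi, rfl⟩ := Finset.mem_image.1 he
    refine ⟨Fin.castSucc_lt_succ, ?_⟩
    have := hc i hi
    simp only [Fin.le_def, Fin.ext_iff, ne_eq, Fin.val_castSucc, Fin.val_succ] at this ⊢
    grind
  · intro τ hτ
    rw [mem_colourPerms] at hτ
    have hle : ∀ a, τ a ≤ c ↔ a ≤ c := fun a => by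
      have := hτ a
      grind
    rw [pathY, map_sum]
    exact Finset.sum_equiv τ (fun a => by simp [hle]) fun a _ => by simp

theorem pathY_succ (i : Fin n) : pathY n K i.succ = pathY n K i.castSucc + X i.succ := by
  have : Finset.Iic i.succ = insert i.succ (Finset.Iic i.castSucc) := by
    ext a
    simp [Fin.le_def, Fin.ext_iff]
    omega
  rw [pathY, pathY, this, Finset.sum_insert (by simp [Fin.le_def]), add_comm (X _)]

theorem pathY_zero : pathY n K 0 = X 0 := by
  have : Finset.Iic (0 : Fin (n + 1)) = {0} := by ext a; simp
  rw [pathY, this, Finset.sum_singleton]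

theorem add_two_mul_pathY (k : ℕ) (hk : k < n) :
    ((k + 2 : ℕ) : MvPolynomial (Fin (n + 1)) K) * pathY n K (⟨k, hk⟩ : Fin n).castSucc =
      ((k + 1 : ℕ) : MvPolynomial (Fin (n + 1)) K) * pathY n K (⟨k, hk⟩ : Fin n).succ +
      ∑ j : Fin n with j.val ≤ k, ((j.val + 1 : ℕ) : MvPolynomial (Fin (n + 1)) K) *
        (X j.castSucc - X j.succ) := by
  induction k with
  | zero =>
    have : Finset.univ.filter (fun j : Fin n => j.val ≤ 0) = {⟨0, hk⟩} := by
      ext j; simp [Fin.ext_iff]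
    rw [this, Finset.sum_singleton, pathY_succ]
    have h0 : (⟨0, hk⟩ : Fin n).castSucc = 0 := rfl
    rw [h0, pathY_zero]
    push_cast
    ring
  | succ k ih =>
    have : Finset.univ.filter (fun j : Fin n => j.val ≤ k + 1) =
        insert ⟨k + 1, hk⟩ (Finset.univ.filter (fun j : Fin n => j.val ≤ k)) := by
      ext j; simp [Fin.ext_iff]; omega
    rw [this, Finset.sum_insert (by simp), pathY_succ]
    have ih := ih (by omega)
    have h1 : (⟨k + 1, hk⟩ : Fin n).castSucc = (⟨k, by omega⟩ : Fin n).succ := rfl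
    rw [pathY_succ] at ih
    rw [h1, pathY_succ]
    push_cast at ih ⊢
    linear_combination ih

theorem add_two_mul_DS_prod_pathY [CharZero K] (k : ℕ) (hk : k < n) :
    ((k + 2 : ℕ) : FractionRing (MvPolynomial (Fin (n + 1)) K)) *
        DS (subpathEdges {i : Fin n | i.val < k + 1})
          (∏ i : Fin n with i.val < k + 1, pathY n K i.castSucc) =
      ((k + 1 : ℕ) : FractionRing (MvPolynomial (Fin (n + 1)) K)) *
        DS (subpathEdges {i : Fin n | i.val < k})
          (∏ i : Fin n with i.val < k, pathY n K i.castSucc) := by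
  have hcard : ∀ l ≤ n, (Finset.univ.filter fun i : Fin n => i.val < l).card = l := fun l hl => by
    simp [Fin.card_filter_val_lt, hl]
  have hins : (Finset.univ.filter fun i : Fin n => i.val < k + 1) =
      insert ⟨k, hk⟩ (Finset.univ.filter fun i : Fin n => i.val < k) := by
    ext i; simp [Fin.ext_iff]; omega
  have hnot : (⟨k, hk⟩ : Fin n) ∉ Finset.univ.filter fun i : Fin n => i.val < k := by simp
  have hle : (Finset.univ.filter fun i : Fin n => i.val ≤ k) =
      Finset.univ.filter fun i : Fin n => i.val < k + 1 := by
    simp only [Nat.lt_succ_iff]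
  have hsucc := hcard (k + 1) hk
  set s := Finset.univ.filter fun i : Fin n => i.val < k + 1 with hs
  set t := Finset.univ.filter fun i : Fin n => i.val < k with ht
  have htdeg : (∏ i ∈ t, pathY n K i.castSucc).totalDegree ≤ k :=
    (totalDegree_prod_pathY_le t Fin.castSucc).trans (hcard k hk.le).le
  have hprod : ∏ i ∈ s, pathY n K i.castSucc =
      pathY n K (⟨k, hk⟩ : Fin n).castSucc * ∏ i ∈ t, pathY n K i.castSucc := by
    rw [hins, Finset.prod_insert hnot]
  rw [← DS_natCast_mul, hprod, ← mul_assoc, add_two_mul_pathY k hk, hle, add_mul, DS_add, mul_assoc,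
    DS_natCast_mul, DS_pathY_mul_eq_zero, mul_zero, zero_add, Finset.sum_mul, DS_sum, hins,
    Finset.sum_insert hnot, ← hins, Finset.sum_eq_zero, add_zero, mul_assoc, DS_natCast_mul,
    DS_subpathEdges_sub_mul (by simp [hs]), hins, Finset.erase_insert hnot]
  · intro i hi
    have his : i ∈ s := by simp [hs, ht] at hi ⊢; omega
    rw [mul_assoc, DS_natCast_mul, DS_subpathEdges_sub_mul his, ← Finset.mul_prod_erase t _ hi,
      DS_pathY_mul_eq_zero, mul_zero]
    · intro j hj
      exact fun h => (Finset.mem_erase.1 hj).1 (Fin.castSucc_injective _ h)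
    · have h1 := totalDegree_prod_pathY_le (K := K) (t.erase i) Fin.castSucc
      have h2 := Finset.card_erase_add_one hi
      have h3 := Finset.card_erase_add_one his
      have h4 := hcard k hk.le
      rw [← ht] at h4
      omega
  · intro i hi
    simp [hs, Fin.ext_iff] at hi ⊢
    omega
  · omega

theorem add_one_mul_DS_prod_pathY [CharZero K] (k : ℕ) (hk : k ≤ n) :
    ((k + 1 : ℕ) : FractionRing (MvPolynomial (Fin (n + 1)) K)) *
        DS (subpathEdges {i : Fin n | i.val < k})
          (∏ i : Fin n with i.val < k, pathY n K i.castSucc) = ((n + 1).factorial : ℕ) := by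
  induction k with
  | zero => simpa [subpathEdges] using DS_empty_one (K := K) (m := n + 1)
  | succ k ih => rw [add_two_mul_DS_prod_pathY k hk, ih (by omega)]

theorem DS_prod_pathY [CharZero K] :
    DS (pathEdges n) (∏ i : Fin n, pathY n K i.castSucc) = (n.factorial : ℕ) := by
  have h := add_one_mul_DS_prod_pathY (K := K) n le_rfl
  simp only [Fin.is_lt, Finset.filter_true, Nat.factorial_succ, subpathEdges_univ] at h
  rw [Nat.cast_mul] at h
  exact mul_left_cancel₀ (Nat.cast_ne_zero.2 n.succ_ne_zero) h

theorem DS_pathY_last_mul [CharZero K] {g : MvPolynomial (Fin (n + 1)) K}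
    (hg : g.totalDegree < n) : DS (pathEdges n) (pathY n K (Fin.last n) * g) = 0 :=
  DS_pathY_mul_eq_zero (s := Finset.univ) _ (fun i _ => (Fin.castSucc_lt_last i).ne) (by simpa)

/-- The toppling relations for the partial sums, with indices modulo `n + 1`. -/
theorem DS_pathY_mul_sub_mul [CharZero K] (i : Fin (n + 1)) {g : MvPolynomial (Fin (n + 1)) K}
    (hg : g.totalDegree + 2 ≤ n) :
    DS (pathEdges n)
      (pathY n K i * (2 * pathY n K i - pathY n K (i - 1) - pathY n K (i + 1)) * g) = 0 := by
  have hdeg : ∀ (a b : Fin (n + 1)), (pathY n K a * g).totalDegree < n := fun a b => by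
    have h1 := totalDegree_mul (pathY n K a) g
    have h2 := totalDegree_pathY_le (K := K) a
    omega
  have hedge : ∀ j : Fin n,
      DS (pathEdges n) (pathY n K j.castSucc * (X j.castSucc - X j.succ) * g) = 0 := fun j => by
    rw [mul_comm (pathY n K j.castSucc), mul_assoc, ← subpathEdges_univ,
      DS_subpathEdges_sub_mul (Finset.mem_univ j)]
    refine DS_pathY_mul_eq_zero _ (fun i hi h => ?_) ?_
    · exact (Finset.mem_erase.1 hi).1 (Fin.castSucc_injective _ h)
    · simp [Finset.card_erase_of_mem]
      omega
  induction i using Fin.lastCases with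
  | last =>
    rw [mul_assoc]
    refine DS_pathY_last_mul ?_
    have h1 := totalDegree_mul
      (2 * pathY n K (Fin.last n) - pathY n K (Fin.last n - 1) - pathY n K (Fin.last n + 1)) g
    have h2 : (2 * pathY n K (Fin.last n) - pathY n K (Fin.last n - 1) -
        pathY n K (Fin.last n + 1)).totalDegree ≤ 1 := by
      refine (totalDegree_sub _ _).trans (max_le ((totalDegree_sub _ _).trans (max_le ?_ ?_)) ?_)
      · rw [two_mul]
        exact (totalDegree_add _ _).trans
          (max_le (totalDegree_pathY_le _) (totalDegree_pathY_le _))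
      · exact totalDegree_pathY_le _
      · exact totalDegree_pathY_le _
    omega
  | cast i =>
    rw [Fin.coeSucc_eq_succ]
    obtain rfl | n := n
    · exact i.elim0
    induction i using Fin.cases with
    | zero =>
      have h0 : (Fin.castSucc (0 : Fin (n + 1))) - 1 = Fin.last (n + 1) := by
        ext; simp
      have : pathY (n + 1) K (Fin.castSucc 0) * (2 * pathY (n + 1) K (Fin.castSucc 0) -
          pathY (n + 1) K (Fin.castSucc 0 - 1) - pathY (n + 1) K (Fin.succ 0)) * g =
          pathY (n + 1) K (Fin.castSucc 0) * (X (Fin.castSucc 0) - X (Fin.succ 0)) * g -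
          pathY (n + 1) K (Fin.last (n + 1)) * (pathY (n + 1) K (Fin.castSucc 0) * g) := by
        rw [h0, pathY_succ, Fin.castSucc_zero, pathY_zero]
        ring
      rw [this, DS_sub, hedge, DS_pathY_last_mul (hdeg _ 0), sub_zero]
    | succ i =>
      have h1 : i.succ.castSucc - 1 = i.castSucc.castSucc := by
        rw [← Fin.succ_castSucc, ← Fin.coeSucc_eq_succ, add_sub_cancel_right]
      refine Eq.trans (congrArg _ ?_) (hedge i.succ)
      rw [h1, pathY_succ, ← Fin.succ_castSucc, pathY_succ]
      ring

/-- The sum over all cyclic shifts in the divided symmetrization, as a function of `h`. -/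
noncomputable def cyclicDS (h : MvPolynomial (Fin (n + 1)) K) :
    FractionRing (MvPolynomial (Fin (n + 1)) K) :=
  DS (pathEdges n) (∑ i : Fin (n + 1), aeval (fun j : Fin (n + 1) => pathY n K (j + i)) h)

theorem totalDegree_aeval_monomial_le (d : Fin (n + 1) →₀ ℕ) (f : Fin (n + 1) → Fin (n + 1)) :
    (aeval (fun j => pathY n K (f j)) (monomial d (1 : K))).totalDegree ≤ d.degree := by
  rw [aeval_monomial, map_one, one_mul]
  refine (totalDegree_finsetProd _ _).trans (Finset.sum_le_sum fun i _ => ?_)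
  refine (totalDegree_pow _ _).trans ?_
  simpa using Nat.mul_le_mul_left (d i) (totalDegree_pathY_le (K := K) (f i))

open Finsupp in
theorem cyclicDS_topple [CharZero K] (d : Fin (n + 1) →₀ ℕ) (i : Fin (n + 1))
    (hd : d.degree + 2 = n) :
    cyclicDS (monomial (d + single i 2) (1 : K)) + cyclicDS (monomial (d + single i 2) (1 : K)) =
      cyclicDS (monomial (d + single i 1 + single (i - 1) 1) (1 : K)) +
      cyclicDS (monomial (d + single i 1 + single (i + 1) 1) (1 : K)) := by
  have key : ∀ k : Fin (n + 1), DS (pathEdges n) (aeval (fun j => pathY n K (j + k))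
      (2 * monomial (d + single i 2) (1 : K) - monomial (d + single i 1 + single (i - 1) 1) (1 : K)
        - monomial (d + single i 1 + single (i + 1) 1) (1 : K))) = 0 := by
    intro k
    have h := DS_pathY_mul_sub_mul (K := K) (i + k)
      (g := aeval (fun j => pathY n K (j + k)) (monomial d (1 : K)))
      ((Nat.add_le_add_right (totalDegree_aeval_monomial_le d (· + k)) 2).trans hd.le)
    rw [← h]
    congr 1
    have e1 : i - 1 + k = i + k - 1 := by abel
    have e2 : i + 1 + k = i + k + 1 := by abel
    have hm : ∀ a b : Fin (n + 1) →₀ ℕ, monomial (a + b) (1 : K) = monomial a 1 * monomial b 1 :=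
      fun a b => by rw [monomial_mul, one_mul]
    have hX : ∀ (a : Fin (n + 1)) (l : ℕ), monomial (single a l) (1 : K) = X a ^ l :=
      fun a l => X_pow_eq_monomial.symm
    simp only [hm, hX, map_sub, map_mul, map_pow, aeval_X, map_ofNat, e1, e2]
    ring
  have hsum : cyclicDS (2 * monomial (d + single i 2) (1 : K) -
      monomial (d + single i 1 + single (i - 1) 1) (1 : K)
        - monomial (d + single i 1 + single (i + 1) 1) (1 : K)) = 0 := by
    rw [cyclicDS, DS_sum]
    exact Finset.sum_eq_zero fun k _ => key k
  simp only [cyclicDS, map_sub, Finset.sum_sub_distrib, DS_sub, two_mul, map_add,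
    Finset.sum_add_distrib, DS_add] at hsum
  simp only [cyclicDS]
  linear_combination hsum

theorem cyclicDS_of_le_one [CharZero K] (c : Fin (n + 1) →₀ ℕ) (hc : c.degree = n)
    (h1 : ∀ i, c i ≤ 1) : cyclicDS (monomial c (1 : K)) = (n.factorial : ℕ) := by
  obtain ⟨k, hk⟩ : ∃ k, ∀ i, c i = if i = k then 0 else 1 := by
    have hsum : ∑ i, (1 - c i) = 1 := by
      have h2 : ∑ i, (1 - c i) + ∑ i, c i = n + 1 := by
        rw [← Finset.sum_add_distrib, Finset.sum_congr rfl fun i _ => Nat.sub_add_cancel (h1 i)]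
        simp
      rw [← Finsupp.degree_eq_sum, hc] at h2
      omega
    obtain ⟨k, -, hk⟩ := Finset.exists_ne_zero_of_sum_ne_zero (hsum.trans_ne one_ne_zero)
    refine ⟨k, fun i => ?_⟩
    split_ifs with hik
    · subst hik; omega
    · have h3 := Finset.sum_le_sum_of_subset (f := fun i => 1 - c i) (Finset.subset_univ {i, k})
      rw [Finset.sum_pair hik, hsum] at h3
      have := h1 i
      omega
  have haeval : ∀ a : Fin (n + 1), aeval (fun j => pathY n K (j + a)) (monomial c (1 : K)) =
      ∏ j ∈ Finset.univ.erase (k + a), pathY n K j := fun a => by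
    rw [aeval_monomial, map_one, one_mul, Finsupp.prod_fintype _ _ (by simp),
      ← Finset.mul_prod_erase _ _ (Finset.mem_univ k), hk, if_pos rfl, pow_zero, one_mul]
    refine Finset.prod_equiv (Equiv.addRight a) (by simp) fun j hj => ?_
    rw [hk, if_neg (Finset.ne_of_mem_erase hj), pow_one]
    rfl
  rw [cyclicDS, DS_sum, Finset.sum_eq_single (Fin.last n - k), haeval, add_sub_cancel,
    ← DS_prod_pathY]
  · congr 1
    rw [Fin.univ_castSuccEmb, Finset.erase_cons, Finset.prod_map]
    rfl
  · intro a _ ha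
    have hmem : Fin.last n ∈ Finset.univ.erase (k + a) := by
      simp only [Finset.mem_erase, Finset.mem_univ, and_true]
      rintro h
      exact ha (by rw [h]; abel)
    rw [haeval, ← Finset.mul_prod_erase _ _ hmem]
    refine DS_pathY_last_mul ?_
    refine (totalDegree_prod_pathY_le (K := K) _ id).trans_lt ?_
    have h2 := Finset.card_erase_add_one hmem
    have h3 : (Finset.univ.erase (k + a)).card = n := by simp
    omega
  · simp

theorem cyclicDS_monomial [CharZero K] (c : Fin (n + 1) →₀ ℕ) (hc : c.degree = n) :
    cyclicDS (monomial c (1 : K)) = (n.factorial : ℕ) :=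
  eq_of_topple_mean (F := fun c => cyclicDS (monomial c (1 : K))) cyclicDS_topple
    cyclicDS_of_le_one c hc

end Path

/-- Theorem 2, Postnikov-type identity: for the path `G` on
`x_0, …, x_n`, `Φ = DS_G`, and `y_i = x_0 + ⋯ + x_i`: for every homogeneous polynomial
`h(t_0, …, t_n)` of degree `n`,
`Φ(Σ_{i=0}^{n} h(y_i, y_{i+1}, …, y_{i+n})) = n! · h(1, 1, …, 1)`,
the inner sum being over all `n + 1` cyclic shifts of the argument list `(y_0, …, y_n)`. -/
theorem divided_symmetrization_cyclic_shifts {K : Type*} [Field K] [CharZero K] (n : ℕ)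
    (h : MvPolynomial (Fin (n + 1)) K) (hh : h.IsHomogeneous n) :
    DS (pathEdges n)
        (∑ i : Fin (n + 1), aeval (fun j : Fin (n + 1) => pathY n K (j + i)) h) =
      (n.factorial : FractionRing (MvPolynomial (Fin (n + 1)) K)) *
        algebraMap (MvPolynomial (Fin (n + 1)) K) (FractionRing (MvPolynomial (Fin (n + 1)) K))
          (C (eval (fun _ : Fin (n + 1) => (1 : K)) h)) := by
  have hlin : DS (pathEdges n)
      (∑ i : Fin (n + 1), aeval (fun j : Fin (n + 1) => pathY n K (j + i)) h) =
      ∑ c ∈ h.support, algebraMap (MvPolynomial (Fin (n + 1)) K)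
        (FractionRing (MvPolynomial (Fin (n + 1)) K)) (C (coeff c h)) *
          cyclicDS (monomial c (1 : K)) := by
    simp only [cyclicDS, ← DS_C_mul, ← DS_sum, Finset.mul_sum]
    rw [Finset.sum_comm]
    congr 1
    refine Finset.sum_congr rfl fun i _ => ?_
    conv_lhs => rw [h.as_sum, map_sum]
    refine Finset.sum_congr rfl fun c _ => ?_
    rw [aeval_monomial, aeval_monomial, map_one, one_mul]
    rfl
  rw [hlin, Finset.sum_congr rfl fun c hc => by
    rw [cyclicDS_monomial c (by
      rw [Finsupp.degree_eq_weight_one]; exact hh (mem_support_iff.1 hc))],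
    ← Finset.sum_mul, ← map_sum, ← map_sum, mul_comm]
  congr 3
  rw [eval_eq]
  simp
end
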